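/- Let X be a normed space, Y a Banach space, and T, S linear relations from X to Y such that D(T) ⊆ D(S) and S(0) ⊆ T(0). Assume S is T-bounded with T-bound less than 1, i.e. there exist constants a ≥ 0 and 0 ≤ b < 1 such that ‖S(x)‖ ≤ a‖x‖ + b‖T(x)‖ for all x ∈ D(T). Then T + S is closed (respectively closable) if and only if T is closed (respectively closable). Moreover, D(cl(T + S)) = D(cl(T)). -/

import Mathlib

open Set Filter Topology

namespace LinRel

variable {X Y : Type*}

/-- The domain `D(A) = {x : exists y, (x,y) in A}` of a linear relation. -/
def dom (A : Set (X × Y)) : Set X := {x | ∃ y, (x, y) ∈ A}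

/-- The range `R(A) = {y : exists x, (x,y) in A}` of a linear relation. -/
def ran (A : Set (X × Y)) : Set Y := {y | ∃ x, (x, y) ∈ A}

/-- The image `A(x) = {y : (x,y) in A}` of a point under a linear relation. -/
def im (A : Set (X × Y)) (x : X) : Set Y := {y | (x, y) ∈ A}

/-- The multivalued part `A(0) = {y : (0,y) in A}` of a linear relation. -/
def mulVal [Zero X] (A : Set (X × Y)) : Set Y := {y | ((0 : X), y) ∈ A}

/-- The null space `N(A) = {x : (x,0) in A}` of a linear relation. -/
def nullSp [Zero Y] (A : Set (X × Y)) : Set X := {x | (x, (0 : Y)) ∈ A}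

/-- The norm `‖A(x)‖` of a linear relation at a point, defined as `d(A(x), A(0))`;
for a linear relation it equals `dist(y, A(0))` for any (equivalently, every) `y ∈ A(x)`. -/
noncomputable def normAt [Zero X] [SeminormedAddCommGroup Y] (A : Set (X × Y)) (x : X) : ℝ :=
  sInf (Set.image2 (fun y z => ‖y - z‖) (im A x) (mulVal A))

/-- The set `{‖A(x)‖ : x ∈ D(A), ‖x‖ ≤ 1}`. -/
noncomputable def normSet [SeminormedAddCommGroup X] [SeminormedAddCommGroup Y]
    (A : Set (X × Y)) : Set ℝ :=
  normAt A '' {x ∈ dom A | ‖x‖ ≤ 1}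

/-- The norm of a linear relation: `‖A‖ = sup {‖A(x)‖ : x ∈ D(A), ‖x‖ ≤ 1}`. -/
noncomputable def rnorm [SeminormedAddCommGroup X] [SeminormedAddCommGroup Y]
    (A : Set (X × Y)) : ℝ :=
  sSup (normSet A)

/-- A linear relation is bounded if its norm is finite, i.e. the set
`{‖A(x)‖ : x ∈ D(A), ‖x‖ ≤ 1}` is bounded above. -/
def IsBdd [SeminormedAddCommGroup X] [SeminormedAddCommGroup Y] (A : Set (X × Y)) : Prop :=
  BddAbove (normSet A)

/-- A relation is closable if its closure has the same images at all points of its domain. -/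
def IsClosableRel [TopologicalSpace X] [TopologicalSpace Y] (A : Set (X × Y)) : Prop :=
  ∀ x ∈ dom A, im (closure A) x = im A x

section ops

variable {K₀ X₀ Y₀ : Type*} [Field K₀] [AddCommGroup X₀] [Module K₀ X₀]
  [AddCommGroup Y₀] [Module K₀ Y₀]

/-- The sum of two linear relations: `T + S := {(x, y + z) : (x,y) ∈ T, (x,z) ∈ S}`. -/
def radd (T S : Submodule K₀ (X₀ × Y₀)) : Submodule K₀ (X₀ × Y₀) where
  carrier := {p | ∃ y z, (p.1, y) ∈ T ∧ (p.1, z) ∈ S ∧ p.2 = y + z}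
  add_mem' := by
    rintro ⟨a, b⟩ ⟨c, d⟩ ⟨y1, z1, h1, h2, rfl⟩ ⟨y2, z2, h3, h4, rfl⟩
    exact ⟨y1 + y2, z1 + z2, T.add_mem h1 h3, S.add_mem h2 h4,
      add_add_add_comm y1 z1 y2 z2⟩
  zero_mem' := ⟨0, 0, T.zero_mem, S.zero_mem, (add_zero 0).symm⟩
  smul_mem' := by
    rintro c ⟨a, b⟩ ⟨y, z, h1, h2, rfl⟩
    exact ⟨c • y, c • z, T.smul_mem c h1, S.smul_mem c h2, smul_add c y z⟩

/-- The scalar multiple of a linear relation: `α T := {(x, α y) : (x, y) ∈ T}`. -/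
def rsmul (α : K₀) (T : Submodule K₀ (X₀ × Y₀)) : Submodule K₀ (X₀ × Y₀) :=
  T.map ((LinearMap.id : X₀ →ₗ[K₀] X₀).prodMap (α • (LinearMap.id : Y₀ →ₗ[K₀] Y₀)))

/-- The difference of two linear relations: `S - T := S + (-1) T`. -/
def rsub (S T : Submodule K₀ (X₀ × Y₀)) : Submodule K₀ (X₀ × Y₀) :=
  radd S (rsmul (-1 : K₀) T)

/-- `T(0)` as a submodule of `Y₀`. -/
def mulSub (T : Submodule K₀ (X₀ × Y₀)) : Submodule K₀ Y₀ :=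
  T.comap (LinearMap.inr K₀ X₀ Y₀)

end ops

end LinRel

open LinRel

namespace LinRel

section normAt

variable {K X Y : Type*} [Ring K] [AddCommGroup X] [Module K X]
  [SeminormedAddCommGroup Y] [Module K Y]

theorem normAt_le_norm (A : Submodule K (X × Y)) {x : X} {y : Y} (h : (x, y) ∈ A) :
    normAt (A : Set (X × Y)) x ≤ ‖y‖ := by
  refine csInf_le ⟨0, ?_⟩ ⟨y, h, 0, A.zero_mem, by simp⟩
  rintro _ ⟨_, _, _, _, rfl⟩
  exact norm_nonneg _

theorem exists_norm_lt_normAt_add (A : Submodule K (X × Y)) {x : X}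
    (hx : x ∈ dom (A : Set (X × Y))) {ε : ℝ} (hε : 0 < ε) :
    ∃ y, (x, y) ∈ A ∧ ‖y‖ < normAt (A : Set (X × Y)) x + ε := by
  obtain ⟨y₀, hy₀⟩ := hx
  have hne : (Set.image2 (fun y z => ‖y - z‖) (im (A : Set (X × Y)) x)
      (mulVal (A : Set (X × Y)))).Nonempty := ⟨_, y₀, hy₀, 0, A.zero_mem, rfl⟩
  obtain ⟨_, ⟨y, hy, z, hz, rfl⟩, hlt⟩ := exists_lt_of_csInf_lt hne (lt_add_of_pos_right _ hε)
  exact ⟨y - z, by simpa using A.sub_mem hy hz, hlt⟩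

end normAt

section closure

variable {K X Y : Type*} [NontriviallyNormedField K] [NormedAddCommGroup X] [NormedSpace K X]
  [NormedAddCommGroup Y] [NormedSpace K Y]

/-- `B` is dominated by `A` if every pair `(x, y)` in `A` is matched, up to arbitrarily small
errors, by a value of `B` at `x` whose norm is at most a fixed multiple of `‖(x, y)‖`. -/
def Dominated (A B : Submodule K (X × Y)) : Prop :=
  ∃ C : ℝ, 0 ≤ C ∧ ∀ p ∈ A, ∀ ε > 0, ∃ w, (p.1, w) ∈ B ∧ ‖w‖ ≤ C * ‖p‖ + ε

theorem Dominated.dom_subset {A B : Submodule K (X × Y)} (h : Dominated A B) :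
    dom (A : Set (X × Y)) ⊆ dom (B : Set (X × Y)) := by
  rintro x ⟨y, hy⟩
  obtain ⟨C, -, hC⟩ := h
  obtain ⟨w, hw, -⟩ := hC _ hy 1 one_pos
  exact ⟨w, hw⟩

theorem Dominated.exists_mem_closure [CompleteSpace Y] {A B : Submodule K (X × Y)}
    (h : Dominated A B) {p : X × Y} (hp : p ∈ closure (A : Set (X × Y))) :
    ∃ w, (p, w) ∈ closure {q : (X × Y) × Y | q.1 ∈ A ∧ (q.1.1, q.2) ∈ B} := by
  obtain ⟨C, hC0, hC⟩ := h
  have hpos : ∀ n : ℕ, 0 < (1 / 2 : ℝ) ^ n := fun n => by positivity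
  obtain ⟨v, hv, hvA, -, hvn⟩ := controlled_sum_of_mem_closure (s := A.toAddSubgroup) hp hpos
  choose w hwB hw using fun n => hC (v n) (hvA n) _ (hpos n)
  have hsum : Summable w := by
    refine Summable.of_norm_bounded_eventually_nat (g := fun n => (C + 1) * (1 / 2 : ℝ) ^ n)
      (summable_geometric_two.mul_left _) ?_
    filter_upwards [eventually_gt_atTop 0] with n hn
    have := mul_le_mul_of_nonneg_left (hvn n hn).le hC0
    linarith [hw n]
  have hlim := (tendsto_add_atTop_iff_nat 1).2 hsum.hasSum.tendsto_sum_nat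
  refine ⟨_, mem_closure_of_tendsto (hv.prodMk_nhds hlim) (Eventually.of_forall fun n => ?_)⟩
  refine ⟨A.sum_mem (t := Finset.range (n + 1)) fun i _ => hvA i, ?_⟩
  have := B.sum_mem (t := Finset.range (n + 1)) fun i _ => hwB i
  convert this using 1
  ext <;> simp [Prod.fst_sum, Prod.snd_sum]

theorem mem_closure_right_of_mem_closure {A B : Submodule K (X × Y)} {p : X × Y} {w : Y}
    (h : (p, w) ∈ closure {q : (X × Y) × Y | q.1 ∈ A ∧ (q.1.1, q.2) ∈ B}) :
    (p.1, w) ∈ closure (B : Set (X × Y)) :=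
  map_mem_closure (f := fun q : (X × Y) × Y => (q.1.1, q.2)) (by fun_prop) h fun _ hq => hq.2

theorem Dominated.dom_closure_subset [CompleteSpace Y] {A B : Submodule K (X × Y)}
    (h : Dominated A B) :
    dom (closure (A : Set (X × Y))) ⊆ dom (closure (B : Set (X × Y))) := by
  rintro x ⟨y, hy⟩
  obtain ⟨w, hw⟩ := h.exists_mem_closure hy
  exact ⟨w, mem_closure_right_of_mem_closure hw⟩

theorem Dominated.mulVal_closure_subset [CompleteSpace Y] {A B : Submodule K (X × Y)}
    (hAB : Dominated A B) (hBA : Dominated B A)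
    (hmul : mulVal (A : Set (X × Y)) = mulVal (B : Set (X × Y)))
    (hA : mulVal (closure (A : Set (X × Y))) ⊆ mulVal (A : Set (X × Y))) :
    mulVal (closure (B : Set (X × Y))) ⊆ mulVal (B : Set (X × Y)) := by
  intro w hw
  obtain ⟨y, hy⟩ := hBA.exists_mem_closure hw
  have hyA : ((0 : X), y) ∈ A := hA (mem_closure_right_of_mem_closure hy)
  rw [← hmul]
  refine hA ?_
  obtain ⟨C, hC0, hC⟩ := hAB
  refine Metric.mem_closure_iff.2 fun ε hε => ?_
  obtain ⟨⟨⟨x', w'⟩, y'⟩, ⟨hB', hA'⟩, hd⟩ :=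
    Metric.mem_closure_iff.1 hy (ε / (C + 2)) (by positivity)
  set δ := ε / (C + 2) with hδ
  have hδ0 : 0 < δ := by positivity
  have hδε : (C + 2) * δ = ε := by rw [hδ]; field_simp
  rw [Prod.dist_eq, max_lt_iff, Prod.dist_eq, max_lt_iff] at hd
  simp only [dist_eq_norm] at hd
  obtain ⟨⟨hx', hw'⟩, hy'⟩ := hd
  have hdiff : (x', y' - y) ∈ A := by simpa using A.sub_mem hA' hyA
  obtain ⟨w'', hw''B, hw''⟩ := hC _ hdiff δ hδ0
  have hp : ‖(x', y' - y)‖ ≤ δ := by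
    refine max_le ?_ ?_
    · simpa using hx'.le
    · simpa [norm_sub_rev] using hy'.le
  have hmem : w' - w'' ∈ mulVal (A : Set (X × Y)) := by
    rw [hmul]
    simpa [mulVal] using B.sub_mem hB' hw''B
  refine ⟨(0, w' - w''), hmem, ?_⟩
  have h1 := mul_le_mul_of_nonneg_left hp hC0
  have h2 : ‖w - (w' - w'')‖ ≤ ‖w - w'‖ + ‖w''‖ := by
    rw [show w - (w' - w'') = (w - w') + w'' by abel]
    exact norm_add_le _ _
  have h3 : ‖w - (w' - w'')‖ < ε := by linarith
  simpa [Prod.dist_eq, dist_eq_norm, hε] using h3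

theorem isClosableRel_iff_mulVal_closure_subset (A : Submodule K (X × Y)) :
    IsClosableRel (A : Set (X × Y)) ↔
      mulVal (closure (A : Set (X × Y))) ⊆ mulVal (A : Set (X × Y)) := by
  refine ⟨fun h => (h 0 ⟨0, A.zero_mem⟩).subset, fun h x hx => ?_⟩
  obtain ⟨y₀, hy₀⟩ := hx
  refine Subset.antisymm (fun y hy => ?_) fun y hy => subset_closure hy
  have hd : ((0 : X), y - y₀) ∈ closure (A : Set (X × Y)) := by
    have := A.topologicalClosure.sub_mem hy (subset_closure hy₀)
    rwa [Prod.mk_sub_mk, sub_self] at this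
  simpa [im] using A.add_mem (h hd) hy₀

theorem isClosed_iff_isClosableRel_and_dom_closure_subset (A : Submodule K (X × Y)) :
    IsClosed (A : Set (X × Y)) ↔ IsClosableRel (A : Set (X × Y)) ∧
      dom (closure (A : Set (X × Y))) ⊆ dom (A : Set (X × Y)) := by
  constructor
  · intro h
    rw [IsClosableRel, h.closure_eq]
    exact ⟨fun _ _ => rfl, Subset.rfl⟩
  · rintro ⟨h, hdom⟩
    refine isClosed_of_closure_subset fun p hp => ?_
    exact (h p.1 (hdom ⟨p.2, hp⟩)).subset hp

theorem Dominated.isClosableRel [CompleteSpace Y] {A B : Submodule K (X × Y)}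
    (hAB : Dominated A B) (hBA : Dominated B A)
    (hmul : mulVal (A : Set (X × Y)) = mulVal (B : Set (X × Y)))
    (hA : IsClosableRel (A : Set (X × Y))) : IsClosableRel (B : Set (X × Y)) := by
  rw [isClosableRel_iff_mulVal_closure_subset] at hA ⊢
  exact hAB.mulVal_closure_subset hBA hmul hA

theorem Dominated.isClosed [CompleteSpace Y] {A B : Submodule K (X × Y)}
    (hAB : Dominated A B) (hBA : Dominated B A)
    (hmul : mulVal (A : Set (X × Y)) = mulVal (B : Set (X × Y)))
    (hA : IsClosed (A : Set (X × Y))) : IsClosed (B : Set (X × Y)) := by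
  rw [isClosed_iff_isClosableRel_and_dom_closure_subset] at hA ⊢
  exact ⟨hAB.isClosableRel hBA hmul hA.1,
    hBA.dom_closure_subset.trans (hA.2.trans hAB.dom_subset)⟩

variable {T S : Submodule K (X × Y)}

theorem mulVal_radd (hmul : mulVal (S : Set (X × Y)) ⊆ mulVal (T : Set (X × Y))) :
    mulVal (radd T S : Set (X × Y)) = mulVal (T : Set (X × Y)) := by
  ext w
  constructor
  · rintro ⟨y, z, hy, hz, rfl⟩
    simpa [mulVal] using T.add_mem hy (hmul hz)
  · exact fun hw => ⟨w, 0, hw, S.zero_mem, (add_zero w).symm⟩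

theorem dominated_radd (hdom : dom (T : Set (X × Y)) ⊆ dom (S : Set (X × Y)))
    {a b : ℝ} (ha : 0 ≤ a) (hb0 : 0 ≤ b)
    (hrel : ∀ x ∈ dom (T : Set (X × Y)),
      normAt (S : Set (X × Y)) x ≤ a * ‖x‖ + b * normAt (T : Set (X × Y)) x) :
    Dominated T (radd T S) := by
  refine ⟨1 + a + b, by positivity, ?_⟩
  rintro ⟨x, y⟩ hxy ε hε
  have hx : x ∈ dom (T : Set (X × Y)) := ⟨y, hxy⟩
  obtain ⟨z, hz, hzn⟩ := exists_norm_lt_normAt_add S (hdom hx) hε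
  refine ⟨y + z, ⟨y, z, hxy, hz, rfl⟩, ?_⟩
  have h1 := mul_le_mul_of_nonneg_left (norm_fst_le (x, y)) ha
  have h2 := mul_le_mul_of_nonneg_left
    ((normAt_le_norm T hxy).trans (norm_snd_le (x, y))) hb0
  have h3 := norm_snd_le (x, y)
  simp only at h1 h2 h3
  linarith [hrel x hx, norm_add_le y z]

theorem radd_dominated (hdom : dom (T : Set (X × Y)) ⊆ dom (S : Set (X × Y)))
    (hmul : mulVal (S : Set (X × Y)) ⊆ mulVal (T : Set (X × Y)))
    {a b : ℝ} (ha : 0 ≤ a) (hb1 : b < 1)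
    (hrel : ∀ x ∈ dom (T : Set (X × Y)),
      normAt (S : Set (X × Y)) x ≤ a * ‖x‖ + b * normAt (T : Set (X × Y)) x) :
    Dominated (radd T S) T := by
  have hb : 0 < 1 - b := sub_pos.2 hb1
  refine ⟨(1 + a) / (1 - b), by positivity, ?_⟩
  rintro ⟨x, w⟩ ⟨y, z, hxy, hxz, hw⟩ ε hε
  simp only at hxy hxz hw
  have hx : x ∈ dom (T : Set (X × Y)) := ⟨y, hxy⟩
  have hle : normAt (T : Set (X × Y)) x ≤ ‖w‖ + normAt (S : Set (X × Y)) x := by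
    refine le_of_forall_pos_le_add fun η hη => ?_
    obtain ⟨z', hz', hzn⟩ := exists_norm_lt_normAt_add S (hdom hx) hη
    have h0 : z - z' ∈ mulVal (T : Set (X × Y)) :=
      hmul (by simpa [mulVal] using S.sub_mem hxz hz')
    have hT : (x, w - z') ∈ T := by
      simpa [hw, add_sub_assoc] using T.add_mem hxy h0
    linarith [normAt_le_norm T hT, norm_sub_le w z']
  obtain ⟨y', hy', hyn⟩ := exists_norm_lt_normAt_add T hx hε
  refine ⟨y', hy', hyn.le.trans (add_le_add_left ?_ ε)⟩
  have h1 := mul_le_mul_of_nonneg_left (norm_fst_le (x, w)) ha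
  have h2 := norm_snd_le (x, w)
  simp only at h1 h2
  rw [div_mul_eq_mul_div, le_div_iff₀ hb]
  linarith [hrel x hx]

end closure

end LinRel

/-- Let `X` be a normed space, `Y` a Banach space, and `T`, `S` linear
relations from `X` to `Y` such that `D(T) ⊆ D(S)` and `S(0) ⊆ T(0)`. Assume `S` is
`T`-bounded with `T`-bound less than `1`, i.e. there exist constants `a ≥ 0` and
`0 ≤ b < 1` with `‖S(x)‖ ≤ a‖x‖ + b‖T(x)‖` for all `x ∈ D(T)`. Then `T + S` is closed
(respectively closable) if and only if `T` is closed (respectively closable). Moreover,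
`D(cl(T + S)) = D(cl(T))`. -/
theorem statement19 {K X Y : Type*} [NontriviallyNormedField K]
    [NormedAddCommGroup X] [NormedSpace K X]
    [NormedAddCommGroup Y] [NormedSpace K Y] [CompleteSpace Y]
    (T S : Submodule K (X × Y))
    (hdom : dom (T : Set (X × Y)) ⊆ dom (S : Set (X × Y)))
    (hmul : mulVal (S : Set (X × Y)) ⊆ mulVal (T : Set (X × Y)))
    (a b : ℝ) (ha : 0 ≤ a) (hb0 : 0 ≤ b) (hb1 : b < 1)
    (hrel : ∀ x ∈ dom (T : Set (X × Y)),
      normAt (S : Set (X × Y)) x ≤ a * ‖x‖ + b * normAt (T : Set (X × Y)) x) :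
    (IsClosed (radd T S : Set (X × Y)) ↔ IsClosed (T : Set (X × Y))) ∧
    (IsClosableRel (radd T S : Set (X × Y)) ↔ IsClosableRel (T : Set (X × Y))) ∧
    dom (closure (radd T S : Set (X × Y))) = dom (closure (T : Set (X × Y))) := by
  have hTR := dominated_radd hdom ha hb0 hrel
  have hRT := radd_dominated hdom hmul ha hb1 hrel
  have hm := mulVal_radd hmul
  exact ⟨⟨hRT.isClosed hTR hm, hTR.isClosed hRT hm.symm⟩,
    ⟨hRT.isClosableRel hTR hm, hTR.isClosableRel hRT hm.symm⟩,
    hRT.dom_closure_subset.antisymm hTR.dom_closure_subset⟩
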